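/- arXiv:2003.11630 — 2 statements merged into one kernel-verified Lean document; each statement's English description precedes it below -/
import Mathlib

section
/- Let d, n ∈ ℕ, let F be a real d×d symmetric positive definite matrix, let g_test ∈ ℝ^d, let g : Fin n → ℝ^d with g i ≠ 0 for every i, and let δ > 0. For each i define φ(i) = sup {|(g_testᵀ F⁻¹ g i)·ε| : ε ∈ ℝ, ((g i)ᵀ F⁻¹ (g i))·ε² ≤ δ²} and ψ(i) = |g_testᵀ F⁻¹ g i| / √((g i)ᵀ F⁻¹ (g i)). Then φ(i) = δ·ψ(i) for every i, and consequently {i : ∀ j, φ(j) ≤ φ(i)} = {i : ∀ j, ψ(j) ≤ ψ(i)}. -/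
open Matrix

theorem isGreatest_abs_mul_of_mul_sq_le (a : ℝ) {b δ : ℝ} (hb : 0 < b) (hδ : 0 ≤ δ) :
    IsGreatest {r : ℝ | ∃ ε : ℝ, b * ε ^ 2 ≤ δ ^ 2 ∧ r = |a * ε|} (δ * (|a| / √b)) := by
  have hs : 0 < √b := Real.sqrt_pos.2 hb
  have hsq : √b ^ 2 = b := Real.sq_sqrt hb.le
  constructor
  · refine ⟨δ / √b, ?_, ?_⟩
    · rw [div_pow, hsq, mul_div_cancel₀ _ hb.ne']
    · rw [abs_mul, abs_of_nonneg (div_nonneg hδ hs.le)]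
      ring
  · rintro r ⟨ε, hε, rfl⟩
    have h : |ε| ≤ δ / √b := by
      refine abs_le_of_sq_le_sq ?_ (div_nonneg hδ hs.le)
      rwa [div_pow, hsq, le_div_iff₀' hb]
    calc |a * ε| = |a| * |ε| := abs_mul a ε
      _ ≤ |a| * (δ / √b) := by gcongr
      _ = δ * (|a| / √b) := by ring

/-- Proposition 2 (ℓ-relative influence): with `φ i` the optimal change in test loss subject to
the expected squared change in loss `((g i)ᵀ F⁻¹ (g i))·ε² ≤ δ²` upon reweighting training
example `i`, and `ψ i = |g_testᵀ F⁻¹ g i| / √((g i)ᵀ F⁻¹ (g i))` the ℓ-relative influence,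
one has `φ i = δ·ψ i` for all `i`, and hence the maximizers of `φ` coincide with the
maximizers of `ψ`. -/
theorem stmt_4 (d n : ℕ) (F : Matrix (Fin d) (Fin d) ℝ) (hsymm : F.IsSymm) (hpd : F.PosDef)
    (gtest : Fin d → ℝ) (g : Fin n → Fin d → ℝ) (hg : ∀ i, g i ≠ 0) (δ : ℝ) (hδ : 0 < δ)
    (φ ψ : Fin n → ℝ)
    (hφ : ∀ i, φ i = sSup {r : ℝ | ∃ ε : ℝ,
      (g i ⬝ᵥ F⁻¹.mulVec (g i)) * ε ^ 2 ≤ δ ^ 2 ∧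
      r = |(gtest ⬝ᵥ F⁻¹.mulVec (g i)) * ε|})
    (hψ : ∀ i, ψ i = |gtest ⬝ᵥ F⁻¹.mulVec (g i)| /
      Real.sqrt (g i ⬝ᵥ F⁻¹.mulVec (g i))) :
    (∀ i, φ i = δ * ψ i) ∧
      {i : Fin n | ∀ j, φ j ≤ φ i} = {i : Fin n | ∀ j, ψ j ≤ ψ i} := by
  have key : ∀ i, φ i = δ * ψ i := fun i => by
    have hpos : 0 < g i ⬝ᵥ F⁻¹.mulVec (g i) := by
      simpa using hpd.inv.dotProduct_mulVec_pos (hg i)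
    rw [hφ, hψ]
    exact (isGreatest_abs_mul_of_mul_sq_le _ hpos hδ.le).csSup_eq
  refine ⟨key, ?_⟩
  ext i
  simp only [Set.mem_ofPred_eq, key, mul_le_mul_iff_right₀ hδ]
end

section
/- Let d, n ∈ ℕ, let ℓ : Fin n → ℝ^d → ℝ be loss functions each twice continuously differentiable, let w : Fin n → ℝ, fix an index j, and let θ : ℝ → ℝ^d be differentiable at 0 such that for all ε in a neighborhood of 0 the first-order stationarity condition ∑_i w i • ∇ℓ_i(θ(ε)) + ε • ∇ℓ_j(θ(ε)) = 0 holds. Let H = ∑_i w i • Hess ℓ_i(θ(0)) (the Hessian of the weighted objective at θ(0), viewed as a linear map ℝ^d → ℝ^d) and assume H is invertible. Then the derivative of θ at 0 equals −H⁻¹ (∇ℓ_j(θ(0))). -/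
open scoped Topology

/-- The gradient of a `C²` function on a real Hilbert space is differentiable. -/
theorem ContDiff.differentiable_gradient {E : Type*} [NormedAddCommGroup E]
    [InnerProductSpace ℝ E] [CompleteSpace E] {f : E → ℝ} (hf : ContDiff ℝ 2 f) :
    Differentiable ℝ (gradient f) := by
  have h : Differentiable ℝ (fderiv ℝ f) :=
    (hf.fderiv_right (m := 1) (by norm_num)).differentiable (by norm_num)
  exact (InnerProductSpace.toDual ℝ E).symm.toContinuousLinearEquiv.differentiable.comp h

/-- Equation (2) of the paper: differentiating the first-order stationarity condition
`∑ i, w i • ∇ℓ_i(θ(ε)) + ε • ∇ℓ_j(θ(ε)) = 0` at `ε = 0` yields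
`dθ/dε |₀ = −H⁻¹ ∇ℓ_j(θ(0))`, where `H = ∑ i, w i • Hess ℓ_i(θ(0))` is the (invertible)
Hessian of the weighted objective at `θ(0)`, with inverse `Hinv`. -/
theorem stmt_7 (d n : ℕ) (ℓ : Fin n → EuclideanSpace ℝ (Fin d) → ℝ)
    (hℓ : ∀ i, ContDiff ℝ 2 (ℓ i)) (w : Fin n → ℝ) (j : Fin n)
    (θ : ℝ → EuclideanSpace ℝ (Fin d)) (hθ : DifferentiableAt ℝ θ 0)
    (hstat : ∀ᶠ ε in 𝓝 (0 : ℝ),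
      ∑ i, w i • gradient (ℓ i) (θ ε) + ε • gradient (ℓ j) (θ ε) = 0)
    (H Hinv : EuclideanSpace ℝ (Fin d) →L[ℝ] EuclideanSpace ℝ (Fin d))
    (hH : H = ∑ i, w i • fderiv ℝ (fun x => gradient (ℓ i) x) (θ 0))
    (hinv₁ : Hinv.comp H = ContinuousLinearMap.id ℝ (EuclideanSpace ℝ (Fin d)))
    (hinv₂ : H.comp Hinv = ContinuousLinearMap.id ℝ (EuclideanSpace ℝ (Fin d))) :
    deriv θ 0 = -Hinv (gradient (ℓ j) (θ 0)) := by
  have hgrad (i : Fin n) : HasDerivAt (fun ε => gradient (ℓ i) (θ ε))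
      (fderiv ℝ (fun x => gradient (ℓ i) x) (θ 0) (deriv θ 0)) 0 :=
    ((hℓ i).differentiable_gradient (θ 0)).hasFDerivAt.comp_hasDerivAt 0 hθ.hasDerivAt
  have hderiv := (HasDerivAt.fun_sum (u := Finset.univ)
    fun i _ => (hgrad i).const_smul (w i)).add ((hasDerivAt_id (0 : ℝ)).smul (hgrad j))
  have hzero := hderiv.unique ((hasDerivAt_const (0 : ℝ) 0).congr_of_eventuallyEq hstat)
  have hsolve : H (deriv θ 0) = -gradient (ℓ j) (θ 0) := by
    rw [eq_neg_iff_add_eq_zero, hH]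
    simpa [sum_apply] using hzero
  calc deriv θ 0 = Hinv (H (deriv θ 0)) := (DFunLike.congr_fun hinv₁ (deriv θ 0)).symm
    _ = -Hinv (gradient (ℓ j) (θ 0)) := by rw [hsolve, map_neg]
end
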